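/- arXiv:1802.08520 — 3 statements merged into one kernel-verified Lean document; each statement's English description precedes it below -/
import Mathlib

section
/- Consider the extremum seeking loop around a linear plant: let ω > 0, T = 2π/ω, and let a, k, ω_h, ω_l be real constants with k ≠ 0 and ω_l ≠ 0. Let A be an n×n real matrix such that iω is not an eigenvalue of A (i.e., det(iωI − A) ≠ 0 over ℂ), let B ∈ ℝⁿ and let C : ℝⁿ → ℝ be linear. Suppose x : ℝ → ℝⁿ and η, ξ, û : ℝ → ℝ are continuously differentiable, all T-periodic, and satisfy for all t: x'(t) = A x(t) + B (û(t) + a sin(ωt)), y(t) = C x(t), η'(t) = ω_h (y(t) − η(t)), ξ'(t) = ω_l ((y(t) − η(t)) sin(ωt) − ξ(t)), and û'(t) = k ξ(t). Then Im( F_H(iω) · G(iω) · (c₁(û) + a/(2i)) ) = 0, where F_H(s) = s/(s + ω_h), G(iω) = C (iωI − A)⁻¹ B (with C, B complexified), and c₁(û) = (1/T) ∫₀^T û(t) e^{−iωt} dt. -/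
open Matrix MeasureTheory

/-- The first Fourier coefficient of a function with period `T`:
`c₁(f) = (1/T) ∫₀^T f(t) e^{-iωt} dt` with `ω = 2π/T`. -/
noncomputable def fourierC1 (T : ℝ) (f : ℝ → ℂ) : ℂ :=
  (1 / (T : ℂ)) * ∫ t in (0:ℝ)..T, f t * Complex.exp (-(Complex.I * (2 * Real.pi / T : ℝ) * t))

/-- The integral `∫₀^T f(t) e^{-iωt} dt` of a real signal `f`. -/
noncomputable def harmonicIntegral (ω T : ℝ) (f : ℝ → ℝ) : ℂ :=
  ∫ t in (0:ℝ)..T, (f t : ℂ) * Complex.exp (-(Complex.I * ω * t))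

namespace harmonicIntegral

variable {ω T : ℝ} {f g : ℝ → ℝ}

theorem intervalIntegrable (hf : Continuous f) :
    IntervalIntegrable (fun t : ℝ => (f t : ℂ) * Complex.exp (-(Complex.I * ω * t)))
      volume 0 T :=
  Continuous.intervalIntegrable (by fun_prop) _ _

theorem add (hf : Continuous f) (hg : Continuous g) :
    harmonicIntegral ω T (fun t => f t + g t) =
      harmonicIntegral ω T f + harmonicIntegral ω T g := by
  unfold harmonicIntegral
  rw [← intervalIntegral.integral_add (intervalIntegrable hf) (intervalIntegrable hg)]
  congr 1 with t
  push_cast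
  ring

theorem const_mul (c : ℝ) (f : ℝ → ℝ) :
    harmonicIntegral ω T (fun t => c * f t) = c * harmonicIntegral ω T f := by
  unfold harmonicIntegral
  rw [← intervalIntegral.integral_const_mul]
  congr 1 with t
  push_cast
  ring

theorem sub (hf : Continuous f) (hg : Continuous g) :
    harmonicIntegral ω T (fun t => f t - g t) =
      harmonicIntegral ω T f - harmonicIntegral ω T g := by
  unfold harmonicIntegral
  rw [← intervalIntegral.integral_sub (intervalIntegrable hf) (intervalIntegrable hg)]
  congr 1 with t
  push_cast
  ring

theorem dotProduct {n : ℕ} (v : Fin n → ℝ) {x : ℝ → Fin n → ℝ} (hx : Continuous x) :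
    harmonicIntegral ω T (fun t => v ⬝ᵥ x t) =
      (Complex.ofReal ∘ v) ⬝ᵥ fun j => harmonicIntegral ω T fun t => x t j := by
  have hsum : harmonicIntegral ω T (fun t => v ⬝ᵥ x t) =
      ∑ j, harmonicIntegral ω T fun t => v j * x t j := by
    unfold harmonicIntegral
    rw [← intervalIntegral.integral_finsetSum fun j _ =>
      intervalIntegrable (f := fun t => v j * x t j) (by fun_prop)]
    congr 1 with t
    simp only [_root_.dotProduct, Complex.ofReal_sum, Finset.sum_mul]
  rw [hsum]
  simp only [const_mul, _root_.dotProduct, Function.comp_apply]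

theorem im_eq (hf : Continuous f) :
    (harmonicIntegral ω T f).im = -∫ t in (0:ℝ)..T, f t * Real.sin (ω * t) := by
  have h := Complex.imCLM.intervalIntegral_comp_comm (intervalIntegrable (ω := ω) (T := T) hf)
  simp only [Complex.imCLM_apply] at h
  unfold harmonicIntegral
  rw [← h, ← intervalIntegral.integral_neg]
  congr 1 with t
  have e : -(Complex.I * ω * t) = ((-(ω * t) : ℝ) : ℂ) * Complex.I := by
    push_cast
    ring
  rw [Complex.im_ofReal_mul, e, Complex.exp_ofReal_mul_I_im, Real.sin_neg, mul_neg]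

theorem of_hasDerivAt {f' : ℝ → ℝ} (hω : ω ≠ 0) (hT : T = 2 * Real.pi / ω)
    (hf : ∀ t, HasDerivAt f (f' t) t) (hf' : Continuous f') (hper : Function.Periodic f T) :
    harmonicIntegral ω T f' = Complex.I * ω * harmonicIntegral ω T f := by
  have hfc : Continuous f := continuous_iff_continuousAt.2 fun t => (hf t).continuousAt
  have hE : ∀ t : ℝ, HasDerivAt (fun t : ℝ => Complex.exp (-(Complex.I * ω * t)))
      (Complex.exp (-(Complex.I * ω * t)) * -(Complex.I * ω)) t := fun t => by
    simpa using (((Complex.ofRealCLM.hasDerivAt (x := t)).const_mul (Complex.I * ω)).neg).cexp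
  have hparts := intervalIntegral.integral_deriv_mul_eq_sub (a := 0) (b := T)
    (fun t _ => (hf t).ofReal_comp) (fun t _ => hE t)
    (Continuous.intervalIntegrable (by fun_prop) _ _)
    (Continuous.intervalIntegrable (by fun_prop) _ _)
  have hexp : Complex.exp (-(Complex.I * ω * T)) = 1 := by
    have e : -(Complex.I * ω * T) = -(2 * Real.pi * Complex.I) := by
      have : (ω : ℂ) ≠ 0 := by exact_mod_cast hω
      rw [hT]
      push_cast
      field_simp
    rw [e, Complex.exp_neg, Complex.exp_two_pi_mul_I, inv_one]
  have hfT : f T = f 0 := by simpa using hper 0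
  rw [intervalIntegral.integral_add (intervalIntegrable hf')
    (Continuous.intervalIntegrable (by fun_prop) _ _), hexp, hfT] at hparts
  have hright : (∫ t in (0:ℝ)..T, (f t : ℂ) *
      (Complex.exp (-(Complex.I * ω * t)) * -(Complex.I * ω))) =
      -(Complex.I * ω) * harmonicIntegral ω T f := by
    unfold harmonicIntegral
    rw [← intervalIntegral.integral_const_mul]
    congr 1 with t
    ring
  rw [hright] at hparts
  simp only [Complex.ofReal_zero, mul_zero, neg_zero, Complex.exp_zero, sub_self] at hparts
  unfold harmonicIntegral at hparts ⊢
  linear_combination hparts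

theorem sin (hω : ω ≠ 0) (hT : T = 2 * Real.pi / ω) :
    harmonicIntegral ω T (fun t => Real.sin (ω * t)) = T / (2 * Complex.I) := by
  have hd : ∀ t : ℝ, HasDerivAt (fun t => Real.sin (ω * t)) (ω * Real.cos (ω * t)) t :=
    fun t => by simpa [mul_comm] using ((hasDerivAt_id t).const_mul ω).sin
  have hper : Function.Periodic (fun t => Real.sin (ω * t)) T := fun t => by
    have e : ω * (t + T) = ω * t + 2 * Real.pi := by
      rw [hT]
      field_simp
    simp only [e, Real.sin_add_two_pi]
  have hcos := of_hasDerivAt hω hT hd (by fun_prop) hper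
  rw [const_mul] at hcos
  have heuler : harmonicIntegral ω T (fun t => Real.cos (ω * t)) +
      Complex.I * harmonicIntegral ω T (fun t => Real.sin (ω * t)) = T := by
    unfold harmonicIntegral
    rw [← intervalIntegral.integral_const_mul, ← intervalIntegral.integral_add
      (intervalIntegrable (f := fun t => Real.cos (ω * t)) (by fun_prop))
      (Continuous.intervalIntegrable (by fun_prop) _ _)]
    have hone : ∀ t : ℝ, ((Real.cos (ω * t) : ℝ) : ℂ) * Complex.exp (-(Complex.I * ω * t)) +
        Complex.I * (((Real.sin (ω * t) : ℝ) : ℂ) * Complex.exp (-(Complex.I * ω * t))) = 1 :=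
      fun t => by
        have e := Complex.exp_mul_I ((ω * t : ℝ) : ℂ)
        rw [← Complex.ofReal_cos, ← Complex.ofReal_sin] at e
        have e' : Complex.exp (((ω * t : ℝ) : ℂ) * Complex.I) *
            Complex.exp (-(Complex.I * ω * t)) = 1 := by
          rw [← Complex.exp_add, ← Complex.exp_zero]
          congr 1
          push_cast
          ring
        rw [e] at e'
        linear_combination e'
    simp only [hone, intervalIntegral.integral_const, sub_zero, Complex.real_smul, mul_one]
  have hω' : (ω : ℂ) ≠ 0 := by exact_mod_cast hω
  have hcos' : harmonicIntegral ω T (fun t => Real.cos (ω * t)) =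
      Complex.I * harmonicIntegral ω T (fun t => Real.sin (ω * t)) :=
    mul_left_cancel₀ hω' (by linear_combination hcos)
  rw [eq_div_iff (by simp)]
  linear_combination heuler - hcos'

end harmonicIntegral

theorem fourierC1_ofReal {ω T : ℝ} (hω : ω ≠ 0) (hT : T = 2 * Real.pi / ω) (f : ℝ → ℝ) :
    fourierC1 T (fun t => (f t : ℂ)) = 1 / T * harmonicIntegral ω T f := by
  have e : 2 * Real.pi / T = ω := by
    have := Real.pi_ne_zero
    rw [hT]
    field_simp
  rw [fourierC1, harmonicIntegral, e]

/-- The derivative of a periodic function has zero mean over a period. -/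
theorem integral_deriv_eq_zero_of_periodic {f : ℝ → ℝ} {T : ℝ} (hf : ContDiff ℝ 1 f)
    (hper : Function.Periodic f T) : ∫ t in (0:ℝ)..T, deriv f t = 0 := by
  rw [intervalIntegral.integral_deriv_eq_sub
    (fun t _ => (hf.differentiable (by norm_num)).differentiableAt)
    ((hf.continuous_deriv le_rfl).intervalIntegrable _ _)]
  simpa [sub_eq_zero] using hper 0

/-- Necessary condition for a periodic stationary solution of the ESC loop around a
linear plant: `Im(F_H(iω) ⬝ G(iω) ⬝ (c₁(uhat) + a/(2i))) = 0`. -/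
theorem esc_necessary_condition {n : ℕ}
    (ω T a k ωh ωl : ℝ) (hω : 0 < ω) (hT : T = 2 * Real.pi / ω)
    (hk : k ≠ 0) (hωl : ωl ≠ 0)
    (A : Matrix (Fin n) (Fin n) ℝ) (B C : Fin n → ℝ)
    (hA : ((Complex.I * (ω : ℂ)) • (1 : Matrix (Fin n) (Fin n) ℂ) -
      A.map Complex.ofReal).det ≠ 0)
    (x : ℝ → Fin n → ℝ) (η ξ uhat : ℝ → ℝ)
    (hx : ContDiff ℝ 1 x) (hη : ContDiff ℝ 1 η) (hξ : ContDiff ℝ 1 ξ)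
    (huhat : ContDiff ℝ 1 uhat)
    (hxT : Function.Periodic x T) (hηT : Function.Periodic η T)
    (hξT : Function.Periodic ξ T) (huhatT : Function.Periodic uhat T)
    (hxd : ∀ t, deriv x t = A.mulVec (x t) + (uhat t + a * Real.sin (ω * t)) • B)
    (hηd : ∀ t, deriv η t = ωh * (C ⬝ᵥ x t - η t))
    (hξd : ∀ t, deriv ξ t = ωl * ((C ⬝ᵥ x t - η t) * Real.sin (ω * t) - ξ t))
    (huhatd : ∀ t, deriv uhat t = k * ξ t) :
    ((Complex.I * (ω : ℂ) / (Complex.I * (ω : ℂ) + (ωh : ℂ))) *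
      ((Complex.ofReal ∘ C) ⬝ᵥ
        ((Complex.I * (ω : ℂ)) • (1 : Matrix (Fin n) (Fin n) ℂ) -
          A.map Complex.ofReal)⁻¹.mulVec (Complex.ofReal ∘ B)) *
      (fourierC1 T (fun t => (uhat t : ℂ)) + (a : ℂ) / (2 * Complex.I))).im = 0 := by
  have hω' : ω ≠ 0 := hω.ne'
  have hT0 : T ≠ 0 := by
    rw [hT]
    positivity
  have hxc := hx.continuous
  have hηc := hη.continuous
  have hξc := hξ.continuous
  have huc := huhat.continuous
  have hyc : Continuous fun t => C ⬝ᵥ x t := by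
    unfold dotProduct
    fun_prop
  set J := harmonicIntegral ω T with hJ
  set X : Fin n → ℂ := fun j => J fun t => x t j
  set M := (Complex.I * (ω : ℂ)) • (1 : Matrix (Fin n) (Fin n) ℂ) - A.map Complex.ofReal with hM
  have hξ_mean : ∫ t in (0:ℝ)..T, ξ t = 0 := by
    have h := integral_deriv_eq_zero_of_periodic huhat huhatT
    simpa [huhatd, hk] using h
  have hdemod : ∫ t in (0:ℝ)..T, (C ⬝ᵥ x t - η t) * Real.sin (ω * t) = 0 := by
    have h := integral_deriv_eq_zero_of_periodic hξ hξT
    simp only [hξd, intervalIntegral.integral_const_mul] at h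
    rw [intervalIntegral.integral_sub (Continuous.intervalIntegrable (by fun_prop) _ _)
      (hξc.intervalIntegrable _ _), hξ_mean, sub_zero] at h
    exact (mul_eq_zero.1 h).resolve_left hωl
  have him : (J fun t => C ⬝ᵥ x t - η t).im = 0 := by
    rw [hJ, harmonicIntegral.im_eq (by fun_prop), hdemod, neg_zero]
  have hy : (J fun t => C ⬝ᵥ x t) = (Complex.ofReal ∘ C) ⬝ᵥ X :=
    harmonicIntegral.dotProduct C hxc
  have hfilter : (ωh : ℂ) * (J fun t => C ⬝ᵥ x t - η t) = Complex.I * ω * J η := by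
    rw [← harmonicIntegral.const_mul]
    refine harmonicIntegral.of_hasDerivAt hω' hT (fun t => ?_) (by fun_prop) hηT
    rw [← hηd]
    exact (hη.differentiable (by norm_num)).differentiableAt.hasDerivAt
  have herr : (J fun t => C ⬝ᵥ x t - η t) = (Complex.ofReal ∘ C) ⬝ᵥ X - J η := by
    rw [← hy]
    exact harmonicIntegral.sub hyc hηc
  have hinput : (J fun t => uhat t + a * Real.sin (ω * t)) =
      J uhat + a * (T / (2 * Complex.I)) := by
    rw [hJ, harmonicIntegral.add huc (by fun_prop), harmonicIntegral.const_mul,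
      harmonicIntegral.sin hω' hT]
  have hplant : M.mulVec X =
      (J uhat + a * (T / (2 * Complex.I))) • (Complex.ofReal ∘ B) := by
    ext i
    have hAc : Continuous fun t => A i ⬝ᵥ x t := by
      unfold dotProduct
      fun_prop
    have hderiv : ∀ t, HasDerivAt (fun t => x t i)
        (A i ⬝ᵥ x t + B i * (uhat t + a * Real.sin (ω * t))) t := fun t => by
      have h := hasDerivAt_pi.1
        ((hx.differentiable (by norm_num)).differentiableAt (x := t)).hasDerivAt i
      rw [hxd] at h
      simpa [Matrix.mulVec, mul_comm] using h
    have h := harmonicIntegral.of_hasDerivAt hω' hT hderiv (by fun_prop)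
      (fun t => by simp only [hxT t])
    rw [harmonicIntegral.add hAc (by fun_prop), harmonicIntegral.const_mul,
      harmonicIntegral.dotProduct _ hxc, ← hJ, hinput] at h
    have hMi : M.mulVec X i = Complex.I * ω * X i - (Complex.ofReal ∘ A i) ⬝ᵥ X := by
      rw [hM, Matrix.sub_mulVec, Matrix.smul_mulVec, Matrix.one_mulVec]
      rfl
    rw [hMi, Pi.smul_apply, smul_eq_mul, Function.comp_apply]
    linear_combination -h
  have hsolve : X = (J uhat + a * (T / (2 * Complex.I))) •
      M⁻¹.mulVec (Complex.ofReal ∘ B) := by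
    rw [← Matrix.mulVec_smul, ← hplant, Matrix.mulVec_mulVec,
      Matrix.nonsing_inv_mul _ (isUnit_iff_ne_zero.2 hA), Matrix.one_mulVec]
  have hden : Complex.I * (ω : ℂ) + ωh ≠ 0 := fun h => by
    have := congrArg Complex.im h
    simp [hω'] at this
  have hTc : (T : ℂ) ≠ 0 := by exact_mod_cast hT0
  have hCX : (Complex.ofReal ∘ C) ⬝ᵥ X = (J uhat + a * (T / (2 * Complex.I))) *
      ((Complex.ofReal ∘ C) ⬝ᵥ M⁻¹.mulVec (Complex.ofReal ∘ B)) := by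
    conv_lhs => rw [hsolve, dotProduct_smul, smul_eq_mul]
  have hgoal : Complex.I * (ω : ℂ) / (Complex.I * ω + ωh) *
      ((Complex.ofReal ∘ C) ⬝ᵥ M⁻¹.mulVec (Complex.ofReal ∘ B)) *
      (fourierC1 T (fun t => (uhat t : ℂ)) + a / (2 * Complex.I)) =
      ((1 / T : ℝ) : ℂ) * J fun t => C ⬝ᵥ x t - η t := by
    have hE : (J fun t => C ⬝ᵥ x t - η t) = Complex.I * (ω : ℂ) / (Complex.I * ω + ωh) *
        ((Complex.ofReal ∘ C) ⬝ᵥ X) := by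
      rw [div_mul_eq_mul_div, eq_div_iff hden]
      linear_combination hfilter + Complex.I * ω * herr
    have hsplit : fourierC1 T (fun t => (uhat t : ℂ)) + a / (2 * Complex.I) =
        1 / T * (J uhat + a * (T / (2 * Complex.I))) := by
      rw [fourierC1_ofReal hω' hT, ← hJ]
      field_simp
    rw [hE, hCX, hsplit]
    push_cast
    ring
  rw [hgoal, Complex.im_ofReal_mul, him, mul_zero]
end

section
/- Let T > 0, ω = 2π/T, let A be an n×n real matrix with det(iωI − A) ≠ 0 over ℂ, let B ∈ ℝⁿ and C : ℝⁿ → ℝ linear. Suppose u : ℝ → ℝ is continuous and T-periodic and x : ℝ → ℝⁿ is continuously differentiable, T-periodic, and satisfies x'(t) = A x(t) + B u(t) for all t. Then the first Fourier coefficients satisfy c₁(C∘x) = G(iω) · c₁(u), where G(iω) = C(iωI − A)⁻¹B (with B, C complexified) and c₁(f) = (1/T) ∫₀^T f(t) e^{−iωt} dt. -/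
open Matrix MeasureTheory

lemma fourierC1_add (T : ℝ) {f g : ℝ → ℂ} (hf : Continuous f) (hg : Continuous g) :
    fourierC1 T (fun t => f t + g t) = fourierC1 T f + fourierC1 T g := by
  simp only [fourierC1, add_mul]
  rw [intervalIntegral.integral_add (Continuous.intervalIntegrable (by fun_prop) _ _)
    (Continuous.intervalIntegrable (by fun_prop) _ _), mul_add]

lemma fourierC1_const_mul (T : ℝ) (a : ℂ) (f : ℝ → ℂ) :
    fourierC1 T (fun t => a * f t) = a * fourierC1 T f := by
  simp only [fourierC1, mul_assoc a, intervalIntegral.integral_const_mul]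
  ring

lemma fourierC1_sum (T : ℝ) {ι : Type*} (s : Finset ι) {f : ι → ℝ → ℂ}
    (hf : ∀ i ∈ s, Continuous (f i)) :
    fourierC1 T (fun t => ∑ i ∈ s, f i t) = ∑ i ∈ s, fourierC1 T (f i) := by
  simp only [fourierC1, Finset.sum_mul]
  rw [intervalIntegral.integral_finsetSum fun i hi =>
    Continuous.intervalIntegrable (by have := hf i hi; fun_prop) _ _, Finset.mul_sum]

/-- Complexified dot products commute with the first Fourier coefficient. -/
lemma fourierC1_dotProduct (T : ℝ) {ι : Type*} [Fintype ι] (v : ι → ℝ) {x : ℝ → ι → ℝ}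
    (hx : Continuous x) :
    fourierC1 T (fun t => ((v ⬝ᵥ x t : ℝ) : ℂ)) =
      (Complex.ofReal ∘ v) ⬝ᵥ fun i => fourierC1 T (fun t => (x t i : ℂ)) := by
  simp only [dotProduct, Complex.ofReal_sum, Complex.ofReal_mul, Function.comp_apply]
  rw [fourierC1_sum T _ fun i _ => by fun_prop]
  simp only [fourierC1_const_mul]

/-- Integration by parts over one period. -/
lemma fourierC1_deriv {T : ℝ} (hT : T ≠ 0) {f f' : ℝ → ℂ} (hf : ∀ t, HasDerivAt f (f' t) t)
    (hf' : Continuous f') (hper : f T = f 0) :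
    fourierC1 T f' = Complex.I * (2 * Real.pi / T : ℝ) * fourierC1 T f := by
  set w : ℂ := Complex.I * (2 * Real.pi / T : ℝ) with hw
  have hexp (t : ℝ) : HasDerivAt (fun t : ℝ => Complex.exp (-(w * t)))
      (-w * Complex.exp (-(w * t))) t := by
    have h := ((Complex.ofRealCLM.hasDerivAt (x := t)).const_mul w).neg.cexp
    simpa [mul_comm] using h
  have hT' : (T : ℂ) ≠ 0 := by exact_mod_cast hT
  have hend : Complex.exp (-(w * T)) = 1 := by
    have h : w * T = 2 * Real.pi * Complex.I := by
      rw [hw]; push_cast; field_simp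
    rw [h, Complex.exp_neg, Complex.exp_two_pi_mul_I, inv_one]
  have hparts := intervalIntegral.integral_deriv_mul_eq_sub
    (a := 0) (b := T) (fun t _ => hf t) (fun t _ => hexp t) (hf'.intervalIntegrable _ _)
    (Continuous.intervalIntegrable (by fun_prop) _ _)
  have hfc : Continuous f := continuous_iff_continuousAt.2 fun t => (hf t).continuousAt
  rw [intervalIntegral.integral_add (Continuous.intervalIntegrable (by fun_prop) _ _)
    (Continuous.intervalIntegrable (by fun_prop) _ _), hend, hper] at hparts
  simp only [mul_left_comm _ (-w), intervalIntegral.integral_const_mul, Complex.ofReal_zero,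
    mul_zero, neg_zero, Complex.exp_zero, sub_self] at hparts
  simp only [fourierC1, ← hw]
  linear_combination (1 / (T : ℂ)) * hparts

/-- A periodic solution of a linear ODE transfers first Fourier coefficients through the
frequency response: `c₁(C∘x) = G(iω)·c₁(u)` with `G(iω) = C(iωI − A)⁻¹B`. -/
theorem fourierCoeff_transfer {n : ℕ} (T ω : ℝ) (hT : 0 < T) (hω : ω = 2 * Real.pi / T)
    (A : Matrix (Fin n) (Fin n) ℝ) (B C : Fin n → ℝ)
    (hA : ((Complex.I * (ω : ℂ)) • (1 : Matrix (Fin n) (Fin n) ℂ) -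
      A.map Complex.ofReal).det ≠ 0)
    (u : ℝ → ℝ) (hu : Continuous u) (huT : Function.Periodic u T)
    (x : ℝ → Fin n → ℝ) (hx : ContDiff ℝ 1 x) (hxT : Function.Periodic x T)
    (hxd : ∀ t, deriv x t = A.mulVec (x t) + u t • B) :
    fourierC1 T (fun t => ((C ⬝ᵥ x t : ℝ) : ℂ)) =
      ((Complex.ofReal ∘ C) ⬝ᵥ
        ((Complex.I * (ω : ℂ)) • (1 : Matrix (Fin n) (Fin n) ℂ) -
          A.map Complex.ofReal)⁻¹.mulVec (Complex.ofReal ∘ B)) *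
        fourierC1 T (fun t => (u t : ℂ)) := by
  have hxi (i : Fin n) (t : ℝ) :
      HasDerivAt (fun t => (x t i : ℂ)) (((A.mulVec (x t) + u t • B) i : ℝ) : ℂ) t := by
    have h := (hx.differentiable one_ne_zero t).hasDerivAt
    rw [hxd] at h
    exact (hasDerivAt_pi.1 h i).ofReal_comp
  have hxc : Continuous x := hx.continuous
  set X : Fin n → ℂ := fun i => fourierC1 T (fun t => (x t i : ℂ)) with hX
  set M := (Complex.I * (ω : ℂ)) • (1 : Matrix (Fin n) (Fin n) ℂ) - A.map Complex.ofReal with hM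
  have hMX : M.mulVec X = fourierC1 T (fun t => (u t : ℂ)) • (Complex.ofReal ∘ B) := by
    funext i
    have hrow : Continuous fun t => ((A i ⬝ᵥ x t : ℝ) : ℂ) :=
      Complex.continuous_ofReal.comp (continuous_const.dotProduct hxc)
    have hsplit : (fun t => (((A.mulVec (x t) + u t • B) i : ℝ) : ℂ)) =
        fun t => ((A i ⬝ᵥ x t : ℝ) : ℂ) + (B i : ℂ) * (u t : ℂ) := by
      funext t
      simp [mulVec, mul_comm]
    have hd := fourierC1_deriv hT.ne' (hxi i) (by rw [hsplit]; fun_prop)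
      (by simpa using congrArg (fun v => ((v i : ℝ) : ℂ)) (hxT 0))
    rw [hsplit, fourierC1_add T hrow (by fun_prop), fourierC1_dotProduct T _ hxc,
      fourierC1_const_mul, ← hω] at hd
    have hMi : M.mulVec X i = Complex.I * ω * X i - (Complex.ofReal ∘ A i) ⬝ᵥ X := by
      rw [hM, sub_mulVec, smul_mulVec, one_mulVec]
      rfl
    rw [hMi, Pi.smul_apply, smul_eq_mul, Function.comp_apply]
    linear_combination -hd
  have hXeq : X = fourierC1 T (fun t => (u t : ℂ)) • M⁻¹.mulVec (Complex.ofReal ∘ B) := by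
    rw [← mulVec_smul, ← hMX, mulVec_mulVec, nonsing_inv_mul _ (isUnit_iff_ne_zero.2 hA),
      one_mulVec]
  rw [fourierC1_dotProduct T C hxc, ← hX, hXeq, dotProduct_smul, smul_eq_mul, mul_comm]
end

section
/- Let ω > 0, T = 2π/ω, ω_l ≠ 0, M ∈ ℝ, and φ ∈ ℝ. Suppose ξ : ℝ → ℝ is continuously differentiable, T-periodic, and satisfies ξ'(t) = ω_l (M sin(ωt + φ) sin(ωt) − ξ(t)) for all t. Then the mean of ξ over one period equals (M/2)·cos(φ); that is, (1/T) ∫₀^T ξ(t) dt = (M/2) cos(φ). -/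
open MeasureTheory

/-- An antiderivative of the demodulated signal `sin (ω t + φ) sin (ω t)`. -/
theorem hasDerivAt_demodulated {ω : ℝ} (hω : ω ≠ 0) (φ t : ℝ) :
    HasDerivAt (fun s => (Real.cos φ * s - Real.sin (2 * ω * s + φ) / (2 * ω)) / 2)
      (Real.sin (ω * t + φ) * Real.sin (ω * t)) t := by
  have hlin : HasDerivAt (fun s : ℝ => 2 * ω * s + φ) (2 * ω) t := by
    simpa using ((hasDerivAt_id t).const_mul (2 * ω)).add_const φ
  have h := ((((hasDerivAt_id t).const_mul (Real.cos φ)).sub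
    (hlin.sin.div_const (2 * ω))).div_const 2)
  refine h.congr_deriv ?_
  have hcos := Real.cos_sub (ω * t + φ) (ω * t)
  have hcos' := Real.cos_add (ω * t + φ) (ω * t)
  rw [show ω * t + φ - ω * t = φ by ring] at hcos
  rw [show ω * t + φ + ω * t = 2 * ω * t + φ by ring] at hcos'
  rw [mul_div_assoc, div_self (mul_ne_zero two_ne_zero hω), hcos, hcos']
  ring

/-- Demodulation and low-pass filtering: if the `T`-periodic state `ξ` satisfies
`ξ' = ω_l(M sin(ωt + φ) sin(ωt) − ξ)` with `ω = 2π/T`, then its mean over one period is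
`(M/2)·cos φ`. -/
theorem lowpass_mean (ω T ωl M φ : ℝ) (hω : 0 < ω) (hT : T = 2 * Real.pi / ω)
    (hωl : ωl ≠ 0)
    (ξ : ℝ → ℝ) (hξ : ContDiff ℝ 1 ξ) (hξT : Function.Periodic ξ T)
    (hξd : ∀ t, deriv ξ t = ωl * (M * Real.sin (ω * t + φ) * Real.sin (ω * t) - ξ t)) :
    (1 / T) * ∫ t in (0:ℝ)..T, ξ t = M / 2 * Real.cos φ := by
  have hTpos : 0 < T := by rw [hT]; positivity
  have hder : ∀ t, HasDerivAt (fun s => M *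
      ((Real.cos φ * s - Real.sin (2 * ω * s + φ) / (2 * ω)) / 2) - ξ s / ωl) (ξ t) t := by
    intro t
    have hξt := (hξ.differentiable one_ne_zero t).hasDerivAt
    refine (((hasDerivAt_demodulated hω.ne' φ t).const_mul M).sub
      (hξt.div_const ωl)).congr_deriv ?_
    rw [hξd t]
    field_simp
    ring
  rw [intervalIntegral.integral_eq_sub_of_hasDerivAt (fun t _ => hder t)
    (hξ.continuous.intervalIntegrable _ _)]
  have hξ0 : ξ T = ξ 0 := by simpa using hξT 0
  have hsin : Real.sin (2 * ω * T + φ) = Real.sin φ := by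
    have harg : 2 * ω * T + φ = φ + (2 : ℕ) * (2 * Real.pi) := by
      rw [hT]
      push_cast
      field_simp
      ring
    rw [harg, Real.sin_add_nat_mul_two_pi]
  rw [hξ0, hsin, mul_zero, mul_zero, zero_add]
  field_simp
  ring
end
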